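/- Let Λ = {A,B}. Let R be the graph with nodes {1,2,3} and two edges: an A-labeled edge from 1 to 2 and a B-labeled edge from 2 to 3. Let T be the graph with nodes {1,2} and four edges: an A-labeled loop at node 1, a B-labeled loop at node 2, an A-labeled edge from 2 to 1, and a B-labeled edge from 2 to 1. Then (R,T) is a duality pair: for every Λ-labeled graph G, there exists a morphism G → T if and only if there exists no morphism R → G. Equivalently, L_R(R) = L(T). -/

import Mathlib

/-- A `Λ`-labeled graph: finite sets of nodes and edges, with source/target maps
and an edge labeling. -/
structure LGraph (Λ : Type) : Type 1 where
  V : Type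
  E : Type
  finV : Finite V
  finE : Finite E
  src : E → V
  tgt : E → V
  lab : E → Λ

/-- A morphism of `Λ`-labeled graphs: maps on nodes and edges commuting with
source and target and preserving labels. -/
structure LGraph.Hom {Λ : Type} (G H : LGraph Λ) : Type where
  fV : G.V → H.V
  fE : G.E → H.E
  src_comm : ∀ e, H.src (fE e) = fV (G.src e)
  tgt_comm : ∀ e, H.tgt (fE e) = fV (G.tgt e)
  lab_comm : ∀ e, H.lab (fE e) = G.lab e

/-- Composition of graph morphisms. -/
def LGraph.Hom.comp {Λ : Type} {G H K : LGraph Λ} (ψ : LGraph.Hom H K)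
    (φ : LGraph.Hom G H) : LGraph.Hom G K where
  fV := ψ.fV ∘ φ.fV
  fE := ψ.fE ∘ φ.fE
  src_comm e := by simp [Function.comp_apply, ψ.src_comm, φ.src_comm]
  tgt_comm e := by simp [Function.comp_apply, ψ.tgt_comm, φ.tgt_comm]
  lab_comm e := by simp [Function.comp_apply, ψ.lab_comm, φ.lab_comm]

/-- `G → H`: there exists some graph morphism from `G` to `H`. -/
def LGraph.Arrow {Λ : Type} (G H : LGraph Λ) : Prop := Nonempty (LGraph.Hom G H)

/-- The type graph language `L(T) = {G | G → T}`. -/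
def TGLang {Λ : Type} (T : LGraph Λ) : Set (LGraph Λ) := {G | LGraph.Arrow G T}

/-- The restriction graph language `L_R(R) = {G | R ↛ G}`. -/
def RGLang {Λ : Type} (R : LGraph Λ) : Set (LGraph Λ) := {G | ¬ LGraph.Arrow R G}

/-- The two-element label set `Λ = {A, B}`. -/
inductive Lab : Type
  | A
  | B
deriving DecidableEq

/-- The restriction graph `R`: nodes `1,2,3` (as `0,1,2 : Fin 3`), with an
`A`-labeled edge `1 → 2` and a `B`-labeled edge `2 → 3`. -/
def Rdual : LGraph Lab where
  V := Fin 3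
  E := Fin 2
  finV := inferInstance
  finE := inferInstance
  src := ![0, 1]
  tgt := ![1, 2]
  lab := ![Lab.A, Lab.B]

/-- The type graph `T`: nodes `1,2` (as `0,1 : Fin 2`), with an `A`-loop at node 1,
a `B`-loop at node 2, an `A`-edge from 2 to 1 and a `B`-edge from 2 to 1. -/
def Tdual : LGraph Lab where
  V := Fin 2
  E := Fin 4
  finV := inferInstance
  finE := inferInstance
  src := ![0, 1, 1, 1]
  tgt := ![0, 1, 0, 0]
  lab := ![Lab.A, Lab.B, Lab.A, Lab.B]

theorem Tdual_key (x : Fin 2 ) (y : Fin 2) (l : Lab) (hA : l = Lab.A → y = 0)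
    (hB : l = Lab.B → x = 1) :
    ∃ e : Fin 4, Tdual.src e = x ∧ Tdual.tgt e = y ∧ Tdual.lab e = l := by
  cases l with
  | A =>
    obtain rfl := hA rfl
    fin_cases x
    · exact ⟨0, rfl, rfl, rfl⟩
    · exact ⟨2, rfl, rfl, rfl⟩
  | B =>
    obtain rfl := hB rfl
    fin_cases y
    · exact ⟨3, rfl, rfl, rfl⟩
    · exact ⟨1, rfl, rfl, rfl⟩

theorem Rdual_not_Tdual : ¬ LGraph.Arrow Rdual Tdual := by
  rintro ⟨φ⟩
  have h1 : Tdual.tgt (φ.fE (0 : Fin 2)) = φ.fV (1 : Fin 3) := φ.tgt_comm (0 : Fin 2)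
  have h2 : Tdual.src (φ.fE (1 : Fin 2)) = φ.fV (1 : Fin 3) := φ.src_comm (1 : Fin 2)
  have h3 : Tdual.lab (φ.fE (0 : Fin 2)) = Lab.A := φ.lab_comm (0 : Fin 2)
  have h4 : Tdual.lab (φ.fE (1 : Fin 2)) = Lab.B := φ.lab_comm (1 : Fin 2)
  have key : ∀ a b : Fin 4, ![Lab.A, Lab.B, Lab.A, Lab.B] a = Lab.A →
      ![Lab.A, Lab.B, Lab.A, Lab.B] b = Lab.B →
      (![0, 1, 0, 0] : Fin 4 → Fin 2) a ≠ (![0, 1, 1, 1] : Fin 4 → Fin 2) b := by decide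
  exact key _ _ h3 h4 (h1.trans h2.symm)

theorem duality_iff (G : LGraph Lab) :
    LGraph.Arrow G Tdual ↔ ¬ LGraph.Arrow Rdual G := by
  classical
  constructor
  · rintro ⟨ψ⟩ ⟨φ⟩
    exact Rdual_not_Tdual ⟨ψ.comp φ⟩
  · intro h
    let f : G.V → Fin 2 := fun v => if ∃ e, G.src e = v ∧ G.lab e = Lab.B then 1 else 0
    have hk : ∀ e : G.E, ∃ e' : Fin 4, Tdual.src e' = f (G.src e) ∧
        Tdual.tgt e' = f (G.tgt e) ∧ Tdual.lab e' = G.lab e := by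
      intro e
      apply Tdual_key
      · intro hA
        refine if_neg ?_
        rintro ⟨e', hs, hB⟩
        refine h ⟨⟨![G.src e, G.tgt e, G.tgt e'], ![e, e'], ?_, ?_, ?_⟩⟩
        · exact Fin.forall_fin_two.2 ⟨rfl, hs⟩
        · exact Fin.forall_fin_two.2 ⟨rfl, rfl⟩
        · exact Fin.forall_fin_two.2 ⟨hA, hB⟩
      · intro hB
        exact if_pos ⟨e, rfl, hB⟩
    choose g hg using hk
    exact ⟨⟨f, g, fun e => (hg e).1, fun e => (hg e).2.1, fun e => (hg e).2.2⟩⟩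

/-- `(R, T)` is a duality pair: for every graph `G`, `G → T` iff `R ↛ G`;
equivalently `L_R(R) = L(T)`. -/
theorem dualityPair_R_T :
    (∀ G : LGraph Lab, LGraph.Arrow G Tdual ↔ ¬ LGraph.Arrow Rdual G) ∧
    RGLang Rdual = TGLang Tdual := by
  exact ⟨duality_iff, Set.ext fun G => (duality_iff G).symm⟩
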